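/- arXiv:1411.4698 — 8 statements merged into one kernel-verified Lean document; each statement's English description precedes it below -/
import Mathlib

section
/- (Ran–Reurings) Let (X,≼) be a partially ordered set in which every pair x,y ∈ X has an upper bound and a lower bound, and let d be a metric on X such that (X,d) is a complete metric space. Let f : X → X be a continuous and monotonic (order-preserving or order-reversing) mapping such that: (i) there exists k ∈ (0,1) with d(f(x),f(y)) ≤ k·d(x,y) for all x,y ∈ X with x ≼ y; (ii) there exists x₀ ∈ X such that x₀ and f(x₀) are comparable. Then f has a unique fixed point x* ∈ X, and lim_{n→∞} fⁿ(x) = x* for every x ∈ X. -/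
open Filter Topology

theorem dist_iterate_le_of_comparable
    {X : Type*} [PseudoMetricSpace X] [Preorder X] {f : X → X}
    (hmono : Monotone f ∨ Antitone f) {k : ℝ} (hk0 : 0 ≤ k)
    (hcontr : ∀ x y : X, x ≤ y → dist (f x) (f y) ≤ k * dist x y)
    {x y : X} (h : x ≤ y ∨ y ≤ x) (n : ℕ) :
    (f^[n] x ≤ f^[n] y ∨ f^[n] y ≤ f^[n] x) ∧
      dist (f^[n] x) (f^[n] y) ≤ dist x y * k ^ n := by
  induction n with
  | zero => simpa using h
  | succ n ih =>
    obtain ⟨hc, hd⟩ := ih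
    simp only [Function.iterate_succ_apply']
    constructor
    · rcases hmono with hm | hm <;> rcases hc with hc | hc
      · exact .inl (hm hc)
      · exact .inr (hm hc)
      · exact .inr (hm hc)
      · exact .inl (hm hc)
    · have hstep : dist (f (f^[n] x)) (f (f^[n] y)) ≤ k * dist (f^[n] x) (f^[n] y) := by
        rcases hc with hc | hc
        · exact hcontr _ _ hc
        · simpa only [dist_comm] using hcontr _ _ hc
      calc _ ≤ k * dist (f^[n] x) (f^[n] y) := hstep
        _ ≤ k * (dist x y * k ^ n) := by gcongr
        _ = dist x y * k ^ (n + 1) := by ring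

theorem tendsto_dist_iterate_of_comparable
    {X : Type*} [PseudoMetricSpace X] [Preorder X] {f : X → X}
    (hmono : Monotone f ∨ Antitone f) {k : ℝ} (hk0 : 0 ≤ k) (hk1 : k < 1)
    (hcontr : ∀ x y : X, x ≤ y → dist (f x) (f y) ≤ k * dist x y)
    {x y : X} (h : x ≤ y ∨ y ≤ x) :
    Tendsto (fun n => dist (f^[n] x) (f^[n] y)) atTop (𝓝 0) :=
  squeeze_zero (fun _ => dist_nonneg)
    (fun n => (dist_iterate_le_of_comparable hmono hk0 hcontr h n).2)
    (by simpa using (tendsto_pow_atTop_nhds_zero_of_lt_one hk0 hk1).const_mul (dist x y))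

theorem ran_reurings_fixed_point
    {X : Type*} [MetricSpace X] [CompleteSpace X] [PartialOrder X]
    (hub : ∀ x y : X, ∃ z : X, x ≤ z ∧ y ≤ z)
    (hlb : ∀ x y : X, ∃ w : X, w ≤ x ∧ w ≤ y)
    (f : X → X) (hcont : Continuous f)
    (hmono : Monotone f ∨ Antitone f)
    (k : ℝ) (hk0 : 0 < k) (hk1 : k < 1)
    (hcontr : ∀ x y : X, x ≤ y → dist (f x) (f y) ≤ k * dist x y)
    (x₀ : X) (hcmp : x₀ ≤ f x₀ ∨ f x₀ ≤ x₀) :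
    ∃ p : X, f p = p ∧ (∀ q : X, f q = q → q = p) ∧
      ∀ x : X, Tendsto (fun n => f^[n] x) atTop (𝓝 p) := by
  have hcauchy : CauchySeq (fun n => f^[n] x₀) :=
    cauchySeq_of_le_geometric k (dist x₀ (f x₀)) hk1
      (fun n => (dist_iterate_le_of_comparable hmono hk0.le hcontr hcmp n).2)
  obtain ⟨p, hp⟩ := cauchySeq_tendsto_of_complete hcauchy
  have hlim : ∀ x : X, Tendsto (fun n => f^[n] x) atTop (𝓝 p) := by
    intro x
    obtain ⟨z, hxz, h0z⟩ := hub x x₀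
    have hz : Tendsto (fun n => f^[n] z) atTop (𝓝 p) :=
      hp.congr_dist (tendsto_dist_iterate_of_comparable hmono hk0.le hk1 hcontr (.inl h0z))
    exact hz.congr_dist (tendsto_dist_iterate_of_comparable hmono hk0.le hk1 hcontr (.inr hxz))
  refine ⟨p, isFixedPt_of_tendsto_iterate hp hcont.continuousAt, fun q hq => ?_, hlim⟩
  refine tendsto_nhds_unique ?_ (hlim q)
  simp [Function.iterate_fixed hq]
end

section
/- Let (X,d) be a metric space and f : X → X a local radial contraction with constant k ∈ (0,1). Then for every rectifiable (continuous) path γ : [0,1] → X, one has d(f(γ(0)), f(γ(1))) ≤ k·l(γ), and the path f∘γ satisfies l(f∘γ) ≤ k·l(γ). -/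
open Set

/-- The length of a path `γ : ℝ → X`, restricted to `[0,1]`, as the supremum over
finite partitions of the sums of distances between consecutive points. -/
noncomputable def pathLength {X : Type*} [MetricSpace X] (γ : ℝ → X) : ENNReal :=
  eVariationOn γ (Set.Icc 0 1)

/-- `f` is a local radial contraction with constant `k`. -/
def LocalRadialContraction {X : Type*} [MetricSpace X] (f : X → X) (k : ℝ) : Prop :=
  ∀ x : X, ∃ εx > (0 : ℝ), ∀ y : X, dist x y < εx → dist (f x) (f y) ≤ k * dist x y

/-- If every point `x` of `[a, b]` has a neighbourhood on which `g` moves away from `g x` at most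
`K` times as fast as `γ` moves away from `γ x`, then the distance between the endpoint values of
`g` is at most `K` times the variation of `γ`. -/
theorem edist_le_mul_eVariationOn_Icc {E F : Type*} [PseudoEMetricSpace E] [PseudoEMetricSpace F]
    {g : ℝ → F} {γ : ℝ → E} {K : ENNReal} {a b : ℝ} (hab : a ≤ b)
    (h : ∀ x ∈ Icc a b, ∃ δ > 0, ∀ y ∈ Icc a b, dist y x < δ →
      edist (g x) (g y) ≤ K * edist (γ x) (γ y)) :
    edist (g a) (g b) ≤ K * eVariationOn γ (Icc a b) := by
  have extend : ∀ y z, a ≤ y → y ≤ z → edist (g a) (g y) ≤ K * eVariationOn γ (Icc a y) →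
      edist (g y) (g z) ≤ K * edist (γ y) (γ z) →
      edist (g a) (g z) ≤ K * eVariationOn γ (Icc a z) := by
    intro y z hay hyz h₁ h₂
    have hV : eVariationOn γ (Icc a y) + eVariationOn γ (Icc y z) = eVariationOn γ (Icc a z) := by
      simpa using eVariationOn.Icc_add_Icc γ (s := univ) hay hyz (mem_univ y)
    calc edist (g a) (g z) ≤ edist (g a) (g y) + edist (g y) (g z) := edist_triangle _ _ _
      _ ≤ K * eVariationOn γ (Icc a y) + K * eVariationOn γ (Icc y z) := by
        gcongr
        exact h₂.trans (by
          gcongr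
          exact eVariationOn.edist_le γ (left_mem_Icc.2 hyz) (right_mem_Icc.2 hyz))
      _ = K * eVariationOn γ (Icc a z) := by rw [← mul_add, hV]
  let S : Set ℝ := {t | ∀ s ∈ Icc a t, edist (g a) (g s) ≤ K * eVariationOn γ (Icc a s)}
  have hS : IsClosed (S ∩ Icc a b) := by
    refine isClosed_of_closure_subset fun x hx ↦ ?_
    have hxI : x ∈ Icc a b := closure_minimal inter_subset_right isClosed_Icc hx
    refine ⟨fun s hs ↦ ?_, hxI⟩
    rcases hs.2.lt_or_eq with hsx | rfl
    · obtain ⟨y, hsy, hyS, -⟩ := mem_closure_iff.1 hx (Ioi s) isOpen_Ioi hsx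
      exact hyS s ⟨hs.1, le_of_lt hsy⟩
    · obtain ⟨δ, hδ, hloc⟩ := h s hxI
      obtain ⟨y, ⟨hyS, hyI⟩, hy⟩ := Metric.mem_closure_iff.1 hx δ hδ
      rcases le_total s y with hsy | hys
      · exact hyS s ⟨hs.1, hsy⟩
      · refine extend y s hyI.1 hys (hyS y ⟨hyI.1, le_rfl⟩) ?_
        rw [edist_comm (g y), edist_comm (γ y)]
        exact hloc y hyI (by rwa [dist_comm])
  have ha : a ∈ S := fun s hs ↦ by
    obtain rfl : s = a := le_antisymm hs.2 hs.1
    simp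
  refine hS.mem_of_ge_of_forall_exists_gt ha hab (fun x hx ↦ ?_) b ⟨hab, le_rfl⟩
  obtain ⟨hxS, hax, hxb⟩ := hx
  obtain ⟨δ, hδ, hloc⟩ := h x ⟨hax, hxb.le⟩
  refine ⟨min b (x + δ / 2), fun s hs ↦ ?_, lt_min hxb (by linarith), min_le_left _ _⟩
  rcases le_total s x with hsx | hxs
  · exact hxS s ⟨hs.1, hsx⟩
  · refine extend x s hax hxs (hxS x ⟨hax, le_rfl⟩)
      (hloc s ⟨hs.1, hs.2.trans (min_le_left _ _)⟩ ?_)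
    have : s ≤ x + δ / 2 := hs.2.trans (min_le_right _ _)
    rw [Real.dist_eq, abs_of_nonneg (by linarith)]
    linarith

/-- A map satisfying a pointwise local Lipschitz bound relative to `γ` on a closed interval has
variation there at most `K` times that of `γ`. -/
theorem eVariationOn_Icc_le_mul {E F : Type*} [PseudoEMetricSpace E] [PseudoEMetricSpace F]
    {g : ℝ → F} {γ : ℝ → E} {K : ENNReal} {a b : ℝ}
    (h : ∀ x ∈ Icc a b, ∃ δ > 0, ∀ y ∈ Icc a b, dist y x < δ →
      edist (g x) (g y) ≤ K * edist (γ x) (γ y)) :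
    eVariationOn g (Icc a b) ≤ K * eVariationOn γ (Icc a b) := by
  refine iSup_le ?_
  rintro ⟨n, u, hu, hus⟩
  calc ∑ i ∈ Finset.range n, edist (g (u (i + 1))) (g (u i))
      ≤ ∑ i ∈ Finset.range n, K * eVariationOn γ (Icc (u i) (u (i + 1))) := by
        refine Finset.sum_le_sum fun i _ ↦ ?_
        have hsub : Icc (u i) (u (i + 1)) ⊆ Icc a b := Icc_subset_Icc (hus i).1 (hus (i + 1)).2
        rw [edist_comm]
        refine edist_le_mul_eVariationOn_Icc (hu i.le_succ) fun x hx ↦ ?_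
        obtain ⟨δ, hδ, hloc⟩ := h x (hsub hx)
        exact ⟨δ, hδ, fun y hy ↦ hloc y (hsub hy)⟩
    _ = K * eVariationOn γ (Icc (u 0) (u n)) := by
        rw [← Finset.mul_sum, eVariationOn.sum' γ hu]
    _ ≤ K * eVariationOn γ (Icc a b) := by
        gcongr
        exact eVariationOn.mono γ (Icc_subset_Icc (hus 0).1 (hus n).2)

theorem LocalRadialContraction.pathLength_comp_le {X : Type*} [MetricSpace X] {f : X → X} {k : ℝ}
    (hk : 0 ≤ k) (hf : LocalRadialContraction f k) {γ : ℝ → X} (hγ : ContinuousOn γ (Icc 0 1)) :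
    pathLength (f ∘ γ) ≤ ENNReal.ofReal k * pathLength γ := by
  refine eVariationOn_Icc_le_mul fun x hx ↦ ?_
  obtain ⟨ε, hε, hfx⟩ := hf (γ x)
  obtain ⟨δ, hδ, hγx⟩ := Metric.continuousOn_iff.1 hγ x hx ε hε
  refine ⟨δ, hδ, fun y hy hyx ↦ ?_⟩
  rw [edist_dist, edist_dist, ← ENNReal.ofReal_mul hk]
  exact ENNReal.ofReal_le_ofReal (hfx _ (by rw [dist_comm]; exact hγx y hy hyx))

theorem local_radial_contraction_path_length
    {X : Type*} [MetricSpace X] (f : X → X) (k : ℝ) (hk0 : 0 < k) (hk1 : k < 1)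
    (hf : LocalRadialContraction f k)
    (γ : ℝ → X) (hγ : ContinuousOn γ (Set.Icc 0 1))
    (hrect : pathLength γ ≠ ⊤) :
    dist (f (γ 0)) (f (γ 1)) ≤ k * (pathLength γ).toReal ∧
      pathLength (f ∘ γ) ≤ ENNReal.ofReal k * pathLength γ := by
  have hlen := hf.pathLength_comp_le hk0.le hγ
  refine ⟨?_, hlen⟩
  have hedist : edist (f (γ 0)) (f (γ 1)) ≤ ENNReal.ofReal k * pathLength γ :=
    (eVariationOn.edist_le (f ∘ γ) (by simp) (by simp)).trans hlen
  have := ENNReal.toReal_mono (ENNReal.mul_ne_top ENNReal.ofReal_ne_top hrect) hedist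
  rwa [ENNReal.toReal_mul, ENNReal.toReal_ofReal hk0.le, ← dist_edist] at this
end

section
/- (Hu–Kirk) Let (X,d) be a complete metric space and f : X → X a local radial contraction with constant k ∈ (0,1). Suppose there exists x₀ ∈ X such that x₀ and f(x₀) are joined by a rectifiable (continuous) path. Then f has a fixed point. -/
open Set

open Filter Topology ENNReal in
/-- If near every point of `[a, b]` the map `g` is radially `K`-Lipschitz with respect to `γ`, then
the endpoints of `g` are at distance at most `K` times the length of `γ`. -/
lemma edist_le_mul_eVariationOn_of_eventually {X Y : Type*} [PseudoEMetricSpace X]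
    [PseudoEMetricSpace Y] {γ : ℝ → X} {g : ℝ → Y} {K : ℝ≥0∞} {a b : ℝ} (hab : a ≤ b)
    (h : ∀ t ∈ Icc a b, ∀ᶠ s in 𝓝[Icc a b] t, edist (g t) (g s) ≤ K * edist (γ t) (γ s)) :
    edist (g a) (g b) ≤ K * eVariationOn γ (Icc a b) := by
  have step : ∀ r s, a ≤ r → r ≤ s → edist (g a) (g r) ≤ K * eVariationOn γ (Icc a r) →
      edist (g r) (g s) ≤ K * edist (γ r) (γ s) →
      edist (g a) (g s) ≤ K * eVariationOn γ (Icc a s) := by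
    intro r s har hrs h1 h2
    have hadd : eVariationOn γ (Icc a r) + eVariationOn γ (Icc r s) = eVariationOn γ (Icc a s) := by
      simpa using eVariationOn.Icc_add_Icc γ (s := univ) har hrs (mem_univ r)
    calc edist (g a) (g s) ≤ edist (g a) (g r) + edist (g r) (g s) := edist_triangle _ _ _
      _ ≤ K * eVariationOn γ (Icc a r) + K * eVariationOn γ (Icc r s) := by
        gcongr
        refine h2.trans ?_
        gcongr
        exact eVariationOn.edist_le γ (left_mem_Icc.2 hrs) (right_mem_Icc.2 hrs)
      _ = K * eVariationOn γ (Icc a s) := by rw [← mul_add, hadd]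
  set S : Set ℝ := {c | c ∈ Icc a b ∧ edist (g a) (g c) ≤ K * eVariationOn γ (Icc a c)}
  have haS : a ∈ S := ⟨left_mem_Icc.2 hab, by simp⟩
  have hbdd : BddAbove S := ⟨b, fun c hc => hc.1.2⟩
  set c := sSup S
  have hac : a ≤ c := le_csSup hbdd haS
  have hcb : c ≤ b := csSup_le ⟨a, haS⟩ fun x hx => hx.1.2
  obtain ⟨δ, hδ, hball⟩ := Metric.mem_nhdsWithin_iff.1 (h c ⟨hac, hcb⟩)
  obtain ⟨r, hrS, hr⟩ := exists_lt_of_lt_csSup ⟨a, haS⟩ (sub_lt_self c hδ)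
  have hrc : r ≤ c := le_csSup hbdd hrS
  have hcS : edist (g a) (g c) ≤ K * eVariationOn γ (Icc a c) := by
    refine step r c hrS.1.1 hrc hrS.2 ?_
    have hrδ : r ∈ Metric.ball c δ := by
      rw [Metric.mem_ball, Real.dist_eq, abs_lt]
      constructor <;> linarith
    rw [edist_comm (g r), edist_comm (γ r)]
    exact hball ⟨hrδ, hrS.1⟩
  rcases hcb.eq_or_lt with hcb' | hlt
  · rwa [hcb'] at hcS
  · have hcs : c < min b (c + δ / 2) := lt_min hlt (by linarith)
    have hsb := min_le_left b (c + δ / 2)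
    have hsδ := min_le_right b (c + δ / 2)
    set s := min b (c + δ / 2)
    have hsI : s ∈ Icc a b := ⟨hac.trans hcs.le, hsb⟩
    have hsball : s ∈ Metric.ball c δ := by
      rw [Metric.mem_ball, Real.dist_eq, abs_lt]
      constructor <;> linarith
    have hsS : s ∈ S := ⟨hsI, step c s hac hcs.le hcS (hball ⟨hsball, hsI⟩)⟩
    exact absurd (le_csSup hbdd hsS) (not_le.2 hcs)

open Filter Topology ENNReal in
lemma LocalRadialContraction.eventually_edist_le {X : Type*} [MetricSpace X] {f : X → X} {k : ℝ}
    (hf : LocalRadialContraction f k) (hk : 0 ≤ k) (x : X) :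
    ∀ᶠ y in 𝓝 x, edist (f x) (f y) ≤ ENNReal.ofReal k * edist x y := by
  obtain ⟨ε, hε, h⟩ := hf x
  filter_upwards [Metric.ball_mem_nhds x hε] with y hy
  rw [edist_dist, edist_dist, ← ENNReal.ofReal_mul hk]
  exact ENNReal.ofReal_le_ofReal (h y (by rwa [dist_comm]))

open Filter Topology in
lemma LocalRadialContraction.continuous {X : Type*} [MetricSpace X] {f : X → X} {k : ℝ}
    (hf : LocalRadialContraction f k) : Continuous f := by
  refine continuous_iff_continuousAt.2 fun x => ?_
  obtain ⟨ε, hε, h⟩ := hf x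
  refine tendsto_iff_dist_tendsto_zero.2 ?_
  have hlim : Tendsto (fun y => k * dist x y) (𝓝 x) (𝓝 0) := by
    have : Continuous fun y => k * dist x y := by fun_prop
    simpa using this.tendsto x
  refine squeeze_zero' (Eventually.of_forall fun _ => dist_nonneg) ?_ hlim
  filter_upwards [Metric.ball_mem_nhds x hε] with y hy
  rw [dist_comm]
  exact h y (by rwa [dist_comm])

open Filter Topology in
lemma LocalRadialContraction.eventually_edist_iterate_le {X : Type*} [MetricSpace X] {f : X → X}
    {k : ℝ} (hf : LocalRadialContraction f k) (hk : 0 ≤ k) (n : ℕ) (x : X) :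
    ∀ᶠ y in 𝓝 x, edist (f^[n] x) (f^[n] y) ≤ ENNReal.ofReal k ^ n * edist x y := by
  induction n with
  | zero => simp
  | succ n ih =>
    have hcont := (hf.continuous.iterate n).tendsto x
    filter_upwards [ih, hcont.eventually (hf.eventually_edist_le hk (f^[n] x))] with y h1 h2
    rw [Function.iterate_succ_apply', Function.iterate_succ_apply', pow_succ', mul_assoc]
    exact h2.trans (by gcongr)

theorem hu_kirk_fixed_point
    {X : Type*} [MetricSpace X] [CompleteSpace X] (f : X → X) (k : ℝ)
    (hk0 : 0 < k) (hk1 : k < 1) (hf : LocalRadialContraction f k)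
    (x₀ : X) (γ : ℝ → X) (hγ : ContinuousOn γ (Set.Icc 0 1))
    (hγ0 : γ 0 = x₀) (hγ1 : γ 1 = f x₀) (hrect : pathLength γ ≠ ⊤) :
    ∃ p : X, f p = p := by
  have hbound : ∀ n, edist (f^[n] x₀) (f^[n + 1] x₀) ≤ pathLength γ * ENNReal.ofReal k ^ n := by
    intro n
    have h := edist_le_mul_eVariationOn_of_eventually (γ := γ) (g := fun t => f^[n] (γ t))
      zero_le_one fun t ht =>
        (hγ t ht).eventually (hf.eventually_edist_iterate_le hk0.le n (γ t))
    simp only [hγ0, hγ1] at h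
    rwa [Function.iterate_succ_apply, mul_comm]
  have hcauchy : CauchySeq fun n => f^[n] x₀ :=
    cauchySeq_of_edist_le_geometric _ _ (by simpa using hk1) hrect hbound
  obtain ⟨p, hp⟩ := cauchySeq_tendsto_of_complete hcauchy
  exact ⟨p, isFixedPt_of_tendsto_iterate hp hf.continuous.continuousAt⟩
end

section
/- Let (X,d) be a metric space and ≼ a transitive binary relation on X. Let f : X → X be relation-preserving (x ≼ y implies f(x) ≼ f(y)), let ε > 0 and k ∈ (0,1) be such that for any comparable x,y ∈ X with d(x,y) < ε one has d(f(x),f(y)) ≤ k·d(x,y), and suppose there is a finite sequence u₀,…,u_m in X with u₀ = x₀, u_m = f(x₀), u_{i-1} ≼ u_i and d(u_{i-1},u_i) < ε for all i = 1,…,m. Then for every natural number n, d(fⁿ(x₀), fⁿ⁺¹(x₀)) ≤ m·kⁿ·ε. -/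
/-- A relation-preserving map that contracts related points at distance less than `ε` by the
factor `k` keeps the iterates of such points related and contracts their distance by `k ^ n`. -/
theorem rel_iterate_and_dist_iterate_le {X : Type*} [PseudoMetricSpace X] {r : X → X → Prop}
    {f : X → X} (hmono : ∀ x y : X, r x y → r (f x) (f y)) {ε k : ℝ} (hk0 : 0 ≤ k) (hk1 : k ≤ 1)
    (hd : ∀ x y : X, r x y → dist x y < ε → dist (f x) (f y) ≤ k * dist x y)
    {x y : X} (hxy : r x y) (hdist : dist x y < ε) (n : ℕ) :
    r (f^[n] x) (f^[n] y) ∧ dist (f^[n] x) (f^[n] y) ≤ k ^ n * dist x y := by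
  induction n with
  | zero => simpa using hxy
  | succ n ih =>
    obtain ⟨hr, hle⟩ := ih
    have hlt : dist (f^[n] x) (f^[n] y) < ε :=
      (hle.trans (mul_le_of_le_one_left dist_nonneg (pow_le_one₀ hk0 hk1))).trans_lt hdist
    rw [Function.iterate_succ_apply', Function.iterate_succ_apply']
    refine ⟨hmono _ _ hr, (hd _ _ hr hlt).trans ?_⟩
    rw [pow_succ', mul_assoc]
    gcongr

theorem iterate_dist_le_of_chain
    {X : Type*} [MetricSpace X] (r : X → X → Prop) (htrans : Transitive r)
    (f : X → X) (hmono : ∀ x y : X, r x y → r (f x) (f y))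
    (ε k : ℝ) (hε : 0 < ε) (hk0 : 0 < k) (hk1 : k < 1)
    (hd : ∀ x y : X, (r x y ∨ r y x) → dist x y < ε →
      dist (f x) (f y) ≤ k * dist x y)
    (x₀ : X) (m : ℕ) (u : ℕ → X) (hu0 : u 0 = x₀) (hum : u m = f x₀)
    (hchain : ∀ i < m, r (u i) (u (i + 1)))
    (hdist : ∀ i < m, dist (u i) (u (i + 1)) < ε) :
    ∀ n : ℕ, dist (f^[n] x₀) (f^[n + 1] x₀) ≤ m * k ^ n * ε := by
  intro n
  have hstep : ∀ {i : ℕ}, i < m → dist (f^[n] (u i)) (f^[n] (u (i + 1))) ≤ k ^ n * ε := by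
    intro i hi
    refine (rel_iterate_and_dist_iterate_le hmono hk0.le hk1.le
      (fun x y hxy => hd x y (Or.inl hxy)) (hchain i hi) (hdist i hi) n).2.trans ?_
    gcongr
    exact (hdist i hi).le
  have hsum := dist_le_range_sum_of_dist_le (f := fun i => f^[n] (u i)) (d := fun _ => k ^ n * ε)
    m hstep
  simpa [hu0, hum, mul_assoc] using hsum
end

section
/- Let (X,d) be a metric space and ≼ a transitive binary relation on X. Let f : X → X be relation-preserving (x ≼ y implies f(x) ≼ f(y)), let ε > 0 and k ∈ (0,1) be such that for any comparable x,y ∈ X with d(x,y) < ε one has d(f(x),f(y)) ≤ k·d(x,y), and suppose there is a finite sequence u₀,…,u_m in X with u₀ = x₀, u_m = f(x₀), u_{i-1} ≼ u_i and d(u_{i-1},u_i) < ε for all i = 1,…,m. Then the sequence of iterates (fⁿ(x₀)) is a Cauchy sequence in (X,d). -/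
/-- A relation-preserving map that contracts related points at distance less than `ε` by a factor
`k` has `n`-th iterate contracting such points by `k ^ n`. -/
theorem dist_iterate_le_of_rel {X : Type*} [PseudoMetricSpace X] {r : X → X → Prop} {f : X → X}
    (hmono : ∀ x y : X, r x y → r (f x) (f y)) {ε k : ℝ} (hk0 : 0 ≤ k) (hk1 : k ≤ 1)
    (hd : ∀ x y : X, r x y → dist x y < ε → dist (f x) (f y) ≤ k * dist x y)
    {x y : X} (hxy : r x y) (hlt : dist x y < ε) (n : ℕ) :
    dist (f^[n] x) (f^[n] y) ≤ k ^ n * dist x y := by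
  induction n generalizing x y with
  | zero => simp
  | succ n ih =>
    have h := hd x y hxy hlt
    have hle : dist (f x) (f y) ≤ dist x y :=
      h.trans (mul_le_of_le_one_left dist_nonneg hk1)
    calc dist (f^[n + 1] x) (f^[n + 1] y)
        = dist (f^[n] (f x)) (f^[n] (f y)) := rfl
      _ ≤ k ^ n * dist (f x) (f y) := ih (hmono x y hxy) (hle.trans_lt hlt)
      _ ≤ k ^ n * (k * dist x y) := by gcongr
      _ = k ^ (n + 1) * dist x y := by ring

theorem iterates_cauchy_of_chain
    {X : Type*} [MetricSpace X] (r : X → X → Prop) (htrans : Transitive r)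
    (f : X → X) (hmono : ∀ x y : X, r x y → r (f x) (f y))
    (ε k : ℝ) (hε : 0 < ε) (hk0 : 0 < k) (hk1 : k < 1)
    (hd : ∀ x y : X, (r x y ∨ r y x) → dist x y < ε →
      dist (f x) (f y) ≤ k * dist x y)
    (x₀ : X) (m : ℕ) (u : ℕ → X) (hu0 : u 0 = x₀) (hum : u m = f x₀)
    (hchain : ∀ i < m, r (u i) (u (i + 1)))
    (hdist : ∀ i < m, dist (u i) (u (i + 1)) < ε) :
    CauchySeq (fun n => f^[n] x₀) := by
  refine cauchySeq_of_le_geometric k (∑ i ∈ Finset.range m, dist (u i) (u (i + 1))) hk1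
    fun n => ?_
  calc dist (f^[n] x₀) (f^[n + 1] x₀)
      = dist (f^[n] (u 0)) (f^[n] (u m)) := by rw [hu0, hum, Function.iterate_succ_apply]
    _ ≤ ∑ i ∈ Finset.range m, dist (f^[n] (u i)) (f^[n] (u (i + 1))) :=
      dist_le_range_sum_dist (fun i => f^[n] (u i)) m
    _ ≤ ∑ i ∈ Finset.range m, k ^ n * dist (u i) (u (i + 1)) := by
      refine Finset.sum_le_sum fun i hi => ?_
      have him := Finset.mem_range.mp hi
      exact dist_iterate_le_of_rel hmono hk0.le hk1.le (fun x y h => hd x y (Or.inl h))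
        (hchain i him) (hdist i him) n
    _ = (∑ i ∈ Finset.range m, dist (u i) (u (i + 1))) * k ^ n := by
      rw [← Finset.mul_sum, mul_comm]
end

section
/- Let (X,d) be a metric space and ≼ a transitive binary relation on X. Let f : X → X be relation-preserving (x ≼ y implies f(x) ≼ f(y)), let ε > 0 and k ∈ (0,1) be such that for any comparable x,y ∈ X with d(x,y) < ε one has d(f(x),f(y)) ≤ k·d(x,y). Suppose x, x₀ ∈ X are joined by a finite sequence v₀,…,v_p with v₀ = x, v_p = x₀, v_{i-1} ≼ v_i and d(v_{i-1},v_i) < ε for all i = 1,…,p, and suppose the sequence (fⁿ(x₀)) converges to some x* ∈ X. Then the sequence (fⁿ(x)) also converges to x*. -/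
open Filter Topology

/-- Iterates of a relation-preserving map that is locally contracting on comparable pairs
contract the distance of two related nearby points geometrically. -/
theorem dist_iterate_le_pow_mul_of_rel {X : Type*} [MetricSpace X] {r : X → X → Prop}
    {f : X → X} (hmono : ∀ x y : X, r x y → r (f x) (f y))
    {ε k : ℝ} (hk0 : 0 ≤ k) (hk1 : k ≤ 1)
    (hd : ∀ x y : X, r x y → dist x y < ε → dist (f x) (f y) ≤ k * dist x y)
    {a b : X} (hr : r a b) (hab : dist a b < ε) (n : ℕ) :
    dist (f^[n] a) (f^[n] b) ≤ k ^ n * dist a b := by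
  induction n generalizing a b with
  | zero => simp
  | succ n ih =>
    have h := hd a b hr hab
    have h' : dist (f a) (f b) < ε :=
      (h.trans (mul_le_of_le_one_left dist_nonneg hk1)).trans_lt hab
    calc dist (f^[n + 1] a) (f^[n + 1] b) ≤ k ^ n * dist (f a) (f b) := ih (hmono a b hr) h'
      _ ≤ k ^ n * (k * dist a b) := by gcongr
      _ = k ^ (n + 1) * dist a b := by ring

theorem iterates_same_limit_of_chain
    {X : Type*} [MetricSpace X] (r : X → X → Prop) (htrans : Transitive r)
    (f : X → X) (hmono : ∀ x y : X, r x y → r (f x) (f y))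
    (ε k : ℝ) (hε : 0 < ε) (hk0 : 0 < k) (hk1 : k < 1)
    (hd : ∀ x y : X, (r x y ∨ r y x) → dist x y < ε →
      dist (f x) (f y) ≤ k * dist x y)
    (x x₀ : X) (p : ℕ) (v : ℕ → X) (hv0 : v 0 = x) (hvp : v p = x₀)
    (hchain : ∀ i < p, r (v i) (v (i + 1)))
    (hdist : ∀ i < p, dist (v i) (v (i + 1)) < ε)
    (xstar : X) (hlim : Tendsto (fun n => f^[n] x₀) atTop (𝓝 xstar)) :
    Tendsto (fun n => f^[n] x) atTop (𝓝 xstar) := by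
  have key : ∀ i ≤ p, Tendsto (fun n => dist (f^[n] (v 0)) (f^[n] (v i))) atTop (𝓝 0) := by
    intro i
    induction i with
    | zero => simp
    | succ i ih =>
      intro hi
      have hgeom : Tendsto (fun n => k ^ n * dist (v i) (v (i + 1))) atTop (𝓝 0) := by
        simpa using (tendsto_pow_atTop_nhds_zero_of_lt_one hk0.le hk1).mul_const
          (dist (v i) (v (i + 1)))
      have hsum := (ih (by omega)).add hgeom
      rw [add_zero] at hsum
      refine squeeze_zero (fun _ => dist_nonneg) (fun n => ?_) hsum
      exact (dist_triangle _ (f^[n] (v i)) _).trans <| by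
        gcongr
        exact dist_iterate_le_pow_mul_of_rel hmono hk0.le hk1.le
          (fun a b hab => hd a b (Or.inl hab)) (hchain i hi) (hdist i hi) n
  subst hv0 hvp
  exact (tendsto_iff_of_dist (key p le_rfl)).mpr hlim
end

section
/- (Edelstein) Let (X,d) be a complete metric space that is ε-chainable for some ε > 0, and let f : X → X satisfy: there exists k ∈ (0,1) such that for all x,y ∈ X with d(x,y) < ε, d(f(x),f(y)) ≤ k·d(x,y). Then f has a unique fixed point. -/
/-- A map contracting all pairs at distance less than `ε` contracts the iterates of such a pair
geometrically. -/
theorem dist_iterate_le_of_locally_contracting {X : Type*} [PseudoMetricSpace X] {ε k : ℝ}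
    {f : X → X} (hk0 : 0 ≤ k) (hk1 : k ≤ 1)
    (hf : ∀ x y : X, dist x y < ε → dist (f x) (f y) ≤ k * dist x y)
    {x y : X} (hxy : dist x y < ε) (n : ℕ) :
    dist (f^[n] x) (f^[n] y) ≤ dist x y * k ^ n := by
  induction n with
  | zero => simp
  | succ n ih =>
    have hlt : dist (f^[n] x) (f^[n] y) < ε :=
      (ih.trans (mul_le_of_le_one_right dist_nonneg (pow_le_one₀ hk0 hk1))).trans_lt hxy
    rw [Function.iterate_succ_apply', Function.iterate_succ_apply']
    calc dist (f (f^[n] x)) (f (f^[n] y)) ≤ k * dist (f^[n] x) (f^[n] y) := hf _ _ hlt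
      _ ≤ k * (dist x y * k ^ n) := by gcongr
      _ = dist x y * k ^ (n + 1) := by ring

/-- Along an `ε`-chain, the iterates of the endpoints approach each other geometrically. -/
theorem dist_iterate_le_sum_of_chain {X : Type*} [PseudoMetricSpace X] {ε k : ℝ}
    {f : X → X} (hk0 : 0 ≤ k) (hk1 : k ≤ 1)
    (hf : ∀ x y : X, dist x y < ε → dist (f x) (f y) ≤ k * dist x y)
    {u : ℕ → X} {m : ℕ} (hu : ∀ i < m, dist (u i) (u (i + 1)) < ε) (n : ℕ) :
    dist (f^[n] (u 0)) (f^[n] (u m)) ≤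
      (∑ i ∈ Finset.range m, dist (u i) (u (i + 1))) * k ^ n := by
  rw [Finset.sum_mul]
  refine (dist_le_range_sum_dist (fun i => f^[n] (u i)) m).trans (Finset.sum_le_sum fun i hi => ?_)
  exact dist_iterate_le_of_locally_contracting hk0 hk1 hf (hu i (Finset.mem_range.mp hi)) n

theorem edelstein_fixed_point
    {X : Type*} [MetricSpace X] [CompleteSpace X] [Nonempty X]
    (ε : ℝ) (hε : 0 < ε)
    (hchain : ∀ x y : X, ∃ (m : ℕ) (u : ℕ → X), u 0 = x ∧ u m = y ∧
      ∀ i < m, dist (u i) (u (i + 1)) < ε)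
    (f : X → X) (k : ℝ) (hk0 : 0 < k) (hk1 : k < 1)
    (hf : ∀ x y : X, dist x y < ε → dist (f x) (f y) ≤ k * dist x y) :
    ∃! p : X, f p = p := by
  have hgeom : ∀ x y : X, ∃ C : ℝ, ∀ n : ℕ, dist (f^[n] x) (f^[n] y) ≤ C * k ^ n := by
    intro x y
    obtain ⟨m, u, rfl, rfl, hu⟩ := hchain x y
    exact ⟨_, dist_iterate_le_sum_of_chain hk0.le hk1.le hf hu⟩
  have hcont : Continuous f := by
    refine Metric.continuous_iff.mpr fun b δ hδ => ⟨min ε δ, lt_min hε hδ, fun a ha => ?_⟩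
    calc dist (f a) (f b) ≤ k * dist a b := hf a b (ha.trans_le (min_le_left _ _))
      _ ≤ dist a b := mul_le_of_le_one_left dist_nonneg hk1.le
      _ < δ := ha.trans_le (min_le_right _ _)
  obtain ⟨x⟩ := ‹Nonempty X›
  obtain ⟨C, hC⟩ := hgeom x (f x)
  obtain ⟨p, hp⟩ := cauchySeq_tendsto_of_complete
    (cauchySeq_of_le_geometric (f := fun n => f^[n] x) k C hk1 hC)
  have hfix : f p = p := isFixedPt_of_tendsto_iterate hp hcont.continuousAt
  refine ⟨p, hfix, fun q hq => ?_⟩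
  obtain ⟨D, hD⟩ := hgeom q p
  have hlim : Filter.Tendsto (fun n : ℕ => D * k ^ n) Filter.atTop (nhds 0) := by
    simpa using (tendsto_pow_atTop_nhds_zero_of_lt_one hk0.le hk1).const_mul D
  refine dist_le_zero.mp (ge_of_tendsto' hlim fun n => ?_)
  simpa only [Function.iterate_fixed hq, Function.iterate_fixed hfix] using hD n
end

section
/- (Rakotch) Let (X,d) be a complete metric space and f : X → X a local contraction with constant k ∈ (0,1), and suppose there exists x₀ ∈ X such that x₀ and f(x₀) are joined by a rectifiable (continuous) path. Then f has a fixed point. -/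
open Set

/-- `f` is a local contraction with constant `k`: around every point there is a ball
on which `f` contracts distances by the factor `k`. -/
def LocalContraction {X : Type*} [MetricSpace X] (f : X → X) (k : ℝ) : Prop :=
  ∀ x : X, ∃ εx > (0 : ℝ), ∀ y z : X, dist x y < εx → dist x z < εx →
    dist (f y) (f z) ≤ k * dist y z

open scoped NNReal Topology

theorem eVariationOn_comp_le_of_locally_lipschitzOnWith {X Y : Type*} [PseudoEMetricSpace X]
    [PseudoEMetricSpace Y] {f : X → Y} {K : ℝ≥0}
    (hf : ∀ x, ∃ s ∈ 𝓝 x, LipschitzOnWith K f s) {g : ℝ → X} {a b : ℝ} (hab : a ≤ b)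
    (hg : ContinuousOn g (Icc a b)) :
    eVariationOn (f ∘ g) (Icc a b) ≤ K * eVariationOn g (Icc a b) := by
  choose s hs hLip using hf
  obtain ⟨t, ht0, ht, ⟨m, hm⟩, hsub⟩ := exists_monotone_Icc_subset_open_cover_Icc hab
    (c := fun x ↦ (Icc a b).domRestrict g ⁻¹' interior (s x))
    (fun x ↦ isOpen_interior.preimage hg.domRestrict)
    (fun u _ ↦ mem_iUnion.2 ⟨g u, mem_interior_iff_mem_nhds.2 (hs (g u))⟩)
  have ht' : Monotone fun n ↦ (t n : ℝ) := fun _ _ h ↦ ht h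
  have hIcc : Icc a b = Icc (t 0 : ℝ) (t m) := by rw [ht0, hm m le_rfl]
  rw [hIcc, ← eVariationOn.sum' _ ht', ← eVariationOn.sum' _ ht', Finset.mul_sum]
  refine Finset.sum_le_sum fun i _ ↦ ?_
  obtain ⟨x, hx⟩ := hsub i
  refine (hLip x).comp_eVariationOn_le fun u hu ↦ ?_
  have hu' : u ∈ Icc a b := ⟨(t i).2.1.trans hu.1, hu.2.trans (t (i + 1)).2.2⟩
  exact interior_subset (hx (show (⟨u, hu'⟩ : Icc a b) ∈ Icc (t i) (t (i + 1)) from hu))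

theorem continuous_of_locally_lipschitzOnWith {X Y : Type*} [PseudoEMetricSpace X]
    [PseudoEMetricSpace Y] {f : X → Y} {K : ℝ≥0}
    (hf : ∀ x, ∃ s ∈ 𝓝 x, LipschitzOnWith K f s) : Continuous f :=
  continuous_iff_continuousAt.2 fun x ↦
    let ⟨_, hs, hLip⟩ := hf x
    hLip.continuousOn.continuousAt hs

theorem LocalContraction.exists_lipschitzOnWith {X : Type*} [MetricSpace X] {f : X → X} {K : ℝ≥0}
    (hf : LocalContraction f K) (x : X) : ∃ s ∈ 𝓝 x, LipschitzOnWith K f s := by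
  obtain ⟨ε, hε, h⟩ := hf x
  refine ⟨Metric.ball x ε, Metric.ball_mem_nhds x hε, LipschitzOnWith.of_dist_le_mul ?_⟩
  intro y hy z hz
  exact h y z (Metric.mem_ball'.1 hy) (Metric.mem_ball'.1 hz)

theorem LocalContraction.eVariationOn_iterate_comp_le {X : Type*} [MetricSpace X] {f : X → X}
    {K : ℝ≥0} (hf : LocalContraction f K) {g : ℝ → X} {a b : ℝ} (hab : a ≤ b)
    (hg : ContinuousOn g (Icc a b)) (n : ℕ) :
    eVariationOn (f^[n] ∘ g) (Icc a b) ≤ K ^ n * eVariationOn g (Icc a b) := by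
  have hcont := continuous_of_locally_lipschitzOnWith hf.exists_lipschitzOnWith
  induction n with
  | zero => simp
  | succ n ih =>
    rw [Function.iterate_succ', Function.comp_assoc, pow_succ', mul_assoc]
    exact (eVariationOn_comp_le_of_locally_lipschitzOnWith hf.exists_lipschitzOnWith hab
      ((hcont.iterate n).comp_continuousOn hg)).trans (by gcongr)

theorem rakotch_fixed_point
    {X : Type*} [MetricSpace X] [CompleteSpace X] (f : X → X) (k : ℝ)
    (hk0 : 0 < k) (hk1 : k < 1) (hf : LocalContraction f k)
    (x₀ : X) (γ : ℝ → X) (hγ : ContinuousOn γ (Set.Icc 0 1))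
    (hγ0 : γ 0 = x₀) (hγ1 : γ 1 = f x₀) (hrect : pathLength γ ≠ ⊤) :
    ∃ p : X, f p = p := by
  lift k to ℝ≥0 using hk0.le
  have hcauchy : CauchySeq fun n ↦ f^[n] x₀ := by
    refine cauchySeq_of_edist_le_geometric (k : ENNReal) (pathLength γ)
      (by exact_mod_cast hk1) hrect fun n ↦ ?_
    calc edist (f^[n] x₀) (f^[n + 1] x₀)
        = edist ((f^[n] ∘ γ) 0) ((f^[n] ∘ γ) 1) := by
          simp [hγ0, hγ1, Function.iterate_succ_apply]
      _ ≤ eVariationOn (f^[n] ∘ γ) (Icc 0 1) := eVariationOn.edist_le _ (by simp) (by simp)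
      _ ≤ k ^ n * pathLength γ := hf.eVariationOn_iterate_comp_le zero_le_one hγ n
      _ = pathLength γ * k ^ n := mul_comm _ _
  obtain ⟨p, hp⟩ := cauchySeq_tendsto_of_complete hcauchy
  exact ⟨p, isFixedPt_of_tendsto_iterate hp
    (continuous_of_locally_lipschitzOnWith hf.exists_lipschitzOnWith).continuousAt⟩
end
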